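/- arXiv:0909.0384 — 5 statements merged into one kernel-verified Lean document; each statement's English description precedes it below -/
import Mathlib

section
/- Let 0 < α < 1 and let a : ℕ → ℝ satisfy a₀ = 1 and lim_{m→∞} a_m m^{(α+1)/2} = 1. For h ∈ ℕ define γ(h) := Σ_{m=0}^∞ a_m a_{m+h}. Then lim_{h→∞} h^α γ(h) = ∫₀^∞ x^{−(α+1)/2}(1+x)^{−(α+1)/2} dx, and this limit is finite and strictly positive. -/
open MeasureTheory Filter

/-- A function of `⌊x⌋₊` integrates over `(0, ∞)` to the sum of its values. -/
lemma integral_Ioi_comp_natFloor (g : ℕ → ℝ)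
    (hg : IntegrableOn (fun x : ℝ => g ⌊x⌋₊) (Set.Ioi 0)) :
    ∫ x in Set.Ioi (0 : ℝ), g ⌊x⌋₊ = ∑' m, g m := by
  have hU : (⋃ m : ℕ, Set.Ico (m : ℝ) (m + 1)) = Set.Ici 0 := by
    ext x
    simp only [Set.mem_iUnion, Set.mem_Ico, Set.mem_Ici]
    exact ⟨fun ⟨m, h, _⟩ => m.cast_nonneg.trans h,
      fun h => ⟨⌊x⌋₊, Nat.floor_le h, Nat.lt_floor_add_one x⟩⟩
  have hfloor : ∀ (m : ℕ) (x : ℝ), x ∈ Set.Ico (m : ℝ) (m + 1) → ⌊x⌋₊ = m := fun m x hx =>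
    (Nat.floor_eq_iff (m.cast_nonneg.trans hx.1)).2 hx
  rw [← integral_Ici_eq_integral_Ioi, ← hU, integral_iUnion (fun _ => measurableSet_Ico)]
  · refine tsum_congr fun m => ?_
    rw [setIntegral_congr_fun (g := fun _ => g m) measurableSet_Ico
      fun x hx => by simp only [hfloor m x hx]]
    simp
  · intro i j hij
    refine Set.disjoint_left.2 fun x hi hj => hij ?_
    rw [← hfloor i x hi, ← hfloor j x hj]
  · rw [hU]
    exact (integrableOn_Ici_iff_integrableOn_Ioi (by simp)).2 hg

lemma integrableOn_rpow_neg_mul_one_add_rpow_neg {d : ℝ} (hd : 1 / 2 < d) (hd1 : d < 1) :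
    IntegrableOn (fun x : ℝ => x ^ (-d) * (1 + x) ^ (-d)) (Set.Ioi 0) := by
  have hmeas : Measurable (fun x : ℝ => x ^ (-d) * (1 + x) ^ (-d)) := by fun_prop
  rw [← Set.Ioc_union_Ioi_eq_Ioi zero_le_one]
  refine IntegrableOn.union ?_ ?_
  · have h : IntegrableOn (fun x : ℝ => x ^ (-d)) (Set.Ioc 0 1) :=
      (intervalIntegrable_iff_integrableOn_Ioc_of_le zero_le_one).1
        (intervalIntegral.intervalIntegrable_rpow' (by linarith))
    refine Integrable.mono' h hmeas.aestronglyMeasurable ?_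
    refine (ae_restrict_iff' measurableSet_Ioc).2 (.of_forall fun x hx => ?_)
    have hx0 : 0 < x := hx.1
    rw [Real.norm_of_nonneg (by positivity)]
    exact mul_le_of_le_one_right (by positivity)
      (Real.rpow_le_one_of_one_le_of_nonpos (by linarith) (by linarith))
  · refine Integrable.mono' (integrableOn_Ioi_rpow_of_lt (a := -d + -d) (by linarith) one_pos)
      hmeas.aestronglyMeasurable ?_
    refine (ae_restrict_iff' measurableSet_Ioi).2 (.of_forall fun x hx => ?_)
    have hx0 : 0 < x := one_pos.trans hx
    rw [Real.norm_of_nonneg (by positivity), Real.rpow_add hx0]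
    exact mul_le_mul_of_nonneg_left
      (Real.rpow_le_rpow_of_nonpos hx0 (by linarith) (by linarith)) (by positivity)

lemma exists_abs_le_rpow_neg {d : ℝ} (hd : 0 < d) {a : ℕ → ℝ} {l : ℝ}
    (ha : Tendsto (fun m : ℕ => a m * (m : ℝ) ^ d) atTop (nhds l)) :
    ∃ C, 0 ≤ C ∧ ∀ (m : ℕ) (y : ℝ), 0 < y → y ≤ m + 1 → |a m| ≤ C * y ^ (-d) := by
  obtain ⟨B, hB⟩ := ha.abs.bddAbove_range
  have hB' : ∀ m : ℕ, |a m| * (m : ℝ) ^ d ≤ B := fun m => by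
    have : |a m * (m : ℝ) ^ d| ≤ B := hB ⟨m, rfl⟩
    rwa [abs_mul, abs_of_nonneg (by positivity : (0 : ℝ) ≤ (m : ℝ) ^ d)] at this
  have hB0 : 0 ≤ B := le_trans (by positivity) (hB' 0)
  refine ⟨|a 0| + B * 2 ^ d, by positivity, fun m y hy hym => ?_⟩
  rw [Real.rpow_neg hy.le, ← div_eq_mul_inv, le_div_iff₀ (by positivity)]
  rcases Nat.eq_zero_or_pos m with rfl | hm
  · have : y ^ d ≤ 1 := Real.rpow_le_one hy.le (by simpa using hym) hd.le
    have h2 : 0 ≤ B * 2 ^ d := by positivity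
    nlinarith [abs_nonneg (a 0)]
  · have hm1 : (1 : ℝ) ≤ m := by exact_mod_cast hm
    calc |a m| * y ^ d ≤ |a m| * (m * 2) ^ d := by gcongr; linarith
      _ = |a m| * (m : ℝ) ^ d * 2 ^ d := by rw [Real.mul_rpow (by positivity) (by norm_num)]; ring
      _ ≤ B * 2 ^ d := by gcongr; exact hB' m
      _ ≤ |a 0| + B * 2 ^ d := by linarith [abs_nonneg (a 0)]

/-- If `a m ~ m ^ (-d)` and `k h / h → x > 0`, then `h ^ d * a (k h) → x ^ (-d)`. -/
lemma tendsto_rpow_mul_comp {d : ℝ} {a : ℕ → ℝ}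
    (ha : Tendsto (fun m : ℕ => a m * (m : ℝ) ^ d) atTop (nhds 1))
    {k : ℕ → ℕ} {x : ℝ} (hx : 0 < x)
    (hk : Tendsto (fun h : ℕ => (k h : ℝ) / h) atTop (nhds x)) :
    Tendsto (fun h : ℕ => (h : ℝ) ^ d * a (k h)) atTop (nhds (x ^ (-d))) := by
  have hkt : Tendsto k atTop atTop := by
    rw [← tendsto_natCast_atTop_iff (R := ℝ)]
    refine (hk.pos_mul_atTop hx tendsto_natCast_atTop_atTop).congr' ?_
    filter_upwards [eventually_gt_atTop 0] with h hh
    field_simp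
  have hlim := (ha.comp hkt).mul (hk.rpow_const (p := -d) (.inl hx.ne'))
  rw [one_mul] at hlim
  refine hlim.congr' ?_
  filter_upwards [eventually_gt_atTop 0, hkt.eventually_gt_atTop 0] with h hh hkh
  have hh' : (0 : ℝ) < h := by exact_mod_cast hh
  have hkh' : (0 : ℝ) < k h := by exact_mod_cast hkh
  simp only [Function.comp]
  rw [Real.div_rpow hkh'.le hh'.le, Real.rpow_neg hkh'.le, Real.rpow_neg hh'.le]
  field_simp

lemma tendsto_rpow_mul_tsum_mul_shift {d : ℝ} (hd : 1 / 2 < d) (hd1 : d < 1) {a : ℕ → ℝ}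
    (ha : Tendsto (fun m : ℕ => a m * (m : ℝ) ^ d) atTop (nhds 1)) :
    Tendsto (fun h : ℕ => (h : ℝ) ^ (2 * d - 1) * ∑' m, a m * a (m + h)) atTop
      (nhds (∫ x in Set.Ioi (0 : ℝ), x ^ (-d) * (1 + x) ^ (-d))) := by
  obtain ⟨C, hC, hbound⟩ := exists_abs_le_rpow_neg (by linarith) ha
  have hint := integrableOn_rpow_neg_mul_one_add_rpow_neg hd hd1
  have hprod : ∀ (h : ℕ) (y : ℝ), 0 < y →
      |a ⌊y⌋₊ * a (⌊y⌋₊ + h)| ≤ C * y ^ (-d) * (C * (h + y) ^ (-d)) := fun h y hy => by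
    have hf := (Nat.lt_floor_add_one y).le
    rw [abs_mul]
    exact mul_le_mul (hbound _ _ hy hf)
      (hbound _ _ (by positivity) (by push_cast; linarith)) (abs_nonneg _) (by positivity)
  have hrescale : ∀ h : ℕ, 0 < h →
      ∫ x in Set.Ioi (0 : ℝ),
        ((h : ℝ) ^ d * a ⌊h * x⌋₊) * ((h : ℝ) ^ d * a (⌊h * x⌋₊ + h)) =
      (h : ℝ) ^ (2 * d - 1) * ∑' m, a m * a (m + h) := fun h hh => by
    have hh' : (0 : ℝ) < h := by exact_mod_cast hh
    have hh1 : (1 : ℝ) ≤ h := by exact_mod_cast hh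
    have hg : IntegrableOn (fun x : ℝ => a ⌊x⌋₊ * a (⌊x⌋₊ + h)) (Set.Ioi 0) := by
      refine Integrable.mono' (hint.const_mul (C * C))
        ((measurable_from_nat (f := fun m => a m * a (m + h))).comp
          Nat.measurable_floor).aestronglyMeasurable ?_
      refine (ae_restrict_iff' measurableSet_Ioi).2 (.of_forall fun x hx => ?_)
      have hx0 : 0 < x := hx
      refine (hprod h x hx0).trans ?_
      calc C * x ^ (-d) * (C * (h + x) ^ (-d))
          ≤ C * x ^ (-d) * (C * (1 + x) ^ (-d)) := by
            gcongr C * x ^ (-d) * (C * ?_)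
            exact Real.rpow_le_rpow_of_nonpos (by linarith) (by linarith) (by linarith)
        _ = _ := by ring
    have hpow : (h : ℝ) ^ (2 * d - 1) = (h : ℝ) ^ d * (h : ℝ) ^ d * (h : ℝ)⁻¹ := by
      rw [← Real.rpow_add hh', ← Real.rpow_neg_one, ← Real.rpow_add hh']
      ring_nf
    have hscale := integral_comp_mul_left_Ioi (fun x : ℝ => a ⌊x⌋₊ * a (⌊x⌋₊ + h)) 0 hh'
    rw [mul_zero, integral_Ioi_comp_natFloor (fun m => a m * a (m + h)) hg, smul_eq_mul] at hscale
    rw [hpow, mul_assoc, ← hscale, ← integral_const_mul]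
    congr 1 with x
    ring
  refine Tendsto.congr' (f₁ := fun h : ℕ => ∫ x in Set.Ioi (0 : ℝ),
        ((h : ℝ) ^ d * a ⌊h * x⌋₊) * ((h : ℝ) ^ d * a (⌊h * x⌋₊ + h))) ?_ ?_
  · filter_upwards [eventually_gt_atTop 0] with h hh using hrescale h hh
  refine tendsto_integral_filter_of_dominated_convergence
    (fun x => C * C * (x ^ (-d) * (1 + x) ^ (-d))) (.of_forall fun h => ?_) ?_
    (hint.const_mul _) ?_
  · exact ((measurable_from_nat
      (f := fun m => ((h : ℝ) ^ d * a m) * ((h : ℝ) ^ d * a (m + h)))).comp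
        (Nat.measurable_floor.comp (measurable_const_mul (h : ℝ)))).aestronglyMeasurable
  · filter_upwards [eventually_gt_atTop 0] with h hh
    refine (ae_restrict_iff' measurableSet_Ioi).2 (.of_forall fun x hx => ?_)
    have hx0 : 0 < x := hx
    have hh' : (0 : ℝ) < h := by exact_mod_cast hh
    calc ‖((h : ℝ) ^ d * a ⌊h * x⌋₊) * ((h : ℝ) ^ d * a (⌊h * x⌋₊ + h))‖
        = (h : ℝ) ^ d * (h : ℝ) ^ d * |a ⌊h * x⌋₊ * a (⌊h * x⌋₊ + h)| := by
          rw [mul_mul_mul_comm, norm_mul, Real.norm_of_nonneg (by positivity), Real.norm_eq_abs]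
      _ ≤ (h : ℝ) ^ d * (h : ℝ) ^ d * (C * (h * x) ^ (-d) * (C * (h + h * x) ^ (-d))) := by
          gcongr
          exact hprod h _ (by positivity)
      _ = C * C * (x ^ (-d) * (1 + x) ^ (-d)) := by
          rw [show (h : ℝ) + h * x = h * (1 + x) by ring, Real.mul_rpow hh'.le hx0.le,
            Real.mul_rpow hh'.le (by positivity), Real.rpow_neg hh'.le]
          field_simp
  · refine (ae_restrict_iff' measurableSet_Ioi).2 (.of_forall fun x hx => ?_)
    have hx0 : 0 < x := hx
    have hfl : Tendsto (fun h : ℕ => (⌊h * x⌋₊ : ℝ) / h) atTop (nhds x) := by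
      simpa only [mul_comm, Function.comp_def] using
        (tendsto_nat_floor_mul_div_atTop hx0.le).comp (tendsto_natCast_atTop_atTop (R := ℝ))
    refine (tendsto_rpow_mul_comp ha hx0 hfl).mul
      (tendsto_rpow_mul_comp ha (k := fun h => ⌊h * x⌋₊ + h) (by positivity) ?_)
    refine (hfl.const_add 1).congr' ?_
    filter_upwards [eventually_gt_atTop 0] with h hh
    have hh' : (0 : ℝ) < h := by exact_mod_cast hh
    push_cast
    field_simp
    ring

/-- Hyperbolic decay of the autocovariances of a long-range-dependent linear process:
if `a₀ = 1` and `a_m m^{(α+1)/2} → 1`, with `γ(h) = Σ_m a_m a_{m+h}`, then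
`h^α γ(h) → ∫₀^∞ x^{-(α+1)/2} (1+x)^{-(α+1)/2} dx`, a finite strictly positive limit. -/
theorem stmt_4 (α : ℝ) (hα0 : 0 < α) (hα1 : α < 1)
    (a : ℕ → ℝ) (ha0 : a 0 = 1)
    (ha : Tendsto (fun m : ℕ => a m * (m : ℝ) ^ ((α + 1) / 2)) atTop (nhds 1))
    (γ : ℕ → ℝ) (hγ : ∀ h : ℕ, γ h = ∑' m : ℕ, a m * a (m + h)) :
    IntegrableOn (fun x : ℝ => x ^ (-(α + 1) / 2) * (1 + x) ^ (-(α + 1) / 2))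
        (Set.Ioi (0 : ℝ)) volume ∧
      0 < ∫ x in Set.Ioi (0 : ℝ), x ^ (-(α + 1) / 2) * (1 + x) ^ (-(α + 1) / 2) ∧
      Tendsto (fun h : ℕ => (h : ℝ) ^ α * γ h) atTop
        (nhds (∫ x in Set.Ioi (0 : ℝ), x ^ (-(α + 1) / 2) * (1 + x) ^ (-(α + 1) / 2))) := by
  have hexp : -(α + 1) / 2 = -((α + 1) / 2) := by ring
  have hαd : α = 2 * ((α + 1) / 2) - 1 := by ring
  have hint := integrableOn_rpow_neg_mul_one_add_rpow_neg (d := (α + 1) / 2)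
    (by linarith) (by linarith)
  rw [hexp]
  refine ⟨hint, ?_, ?_⟩
  · have hpos : ∀ x ∈ Set.Ioi (0 : ℝ),
        0 < x ^ (-((α + 1) / 2)) * (1 + x) ^ (-((α + 1) / 2)) := fun x hx => by
      have hx0 : 0 < x := hx
      positivity
    rw [setIntegral_pos_iff_support_of_nonneg_ae
      ((ae_restrict_iff' measurableSet_Ioi).2 (.of_forall fun x hx => (hpos x hx).le)) hint,
      Set.inter_eq_right.2 fun x hx => Function.mem_support.2 (hpos x hx).ne']
    simp
  · simp only [hγ]
    have hlim := tendsto_rpow_mul_tsum_mul_shift (by linarith) (by linarith) ha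
    rwa [← hαd] at hlim
end

section
/- Let 0 < p < ∞, s > 0, and let q_D = p/(2s+1). Let π > q_D. Then there exists a constant C < ∞, depending only on p, s and π, such that for every M > 0 and every doubly-indexed real sequence β = (β_{j,k})_{j≥0, 0≤k<2^j} with sup_{j≥0} 2^{j(s+1/2−1/π)} (Σ_{k=0}^{2^j−1} |β_{j,k}|^π)^{1/π} ≤ M, one has sup_{λ>0} λ^{q_D} Σ_{(j,k): |β_{j,k}|>λ} 2^{j(p/2−1)} ≤ C·M^{q_D}. -/
open MeasureTheory ENNReal

/-- Chebyshev's inequality for finite sums. -/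
lemma card_filter_lt_abs_mul_rpow_le {ι : Type*} (S : Finset ι) (b : ι → ℝ) {t r : ℝ}
    (ht : 0 < t) (hr : 0 < r) :
    ((S.filter fun k => t < |b k|).card : ℝ) * t ^ r ≤ ∑ k ∈ S, |b k| ^ r := by
  rw [← nsmul_eq_mul]
  refine (Finset.card_nsmul_le_sum _ (fun k => |b k| ^ r) _ fun k hk => ?_).trans
    (Finset.sum_le_sum_of_subset_of_nonneg (Finset.filter_subset _ _) fun _ _ _ => by positivity)
  exact Real.rpow_le_rpow ht.le (Finset.mem_filter.mp hk).2.le hr.le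

/-- The minimum of the two bounds on the weighted number of large coefficients at level `x`
decays geometrically away from the critical level `y`. -/
lemma min_exponent_le {a q r x y : ℝ} (ha : 0 < a) :
    min (x * (a * q)) (a * r * y - x * (a * r) + x * (a * q)) ≤
      a * q * y - a * min q (r - q) * |x - y| := by
  rcases le_total x y with h | h
  · refine (min_le_left _ _).trans ?_
    rw [abs_of_nonpos (by linarith)]
    have := mul_le_mul_of_nonneg_right (min_le_left q (r - q))
      (mul_nonneg ha.le (sub_nonneg.mpr h))
    nlinarith
  · refine (min_le_right _ _).trans ?_
    rw [abs_of_nonneg (by linarith)]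
    have := mul_le_mul_of_nonneg_right (min_le_right q (r - q))
      (mul_nonneg ha.le (sub_nonneg.mpr h))
    nlinarith

lemma natAbs_sub_floor_sub_one_le (j : ℕ) (y : ℝ) :
    (((j : ℤ) - ⌊y⌋).natAbs : ℝ) - 1 ≤ |(j : ℝ) - y| := by
  have h : (((j : ℤ) - ⌊y⌋).natAbs : ℝ) = |(j : ℝ) - ⌊y⌋| := by
    rw [Nat.cast_natAbs]; push_cast; rfl
  have h₁ := abs_sub_le (j : ℝ) y ⌊y⌋
  have h₂ : |y - ⌊y⌋| ≤ 1 := by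
    rw [abs_of_nonneg (sub_nonneg.mpr (Int.floor_le y))]
    linarith [Int.lt_floor_add_one y]
  linarith

lemma summable_pow_natAbs {ρ : ℝ} (h₀ : 0 ≤ ρ) (h₁ : ρ < 1) :
    Summable fun n : ℤ => ρ ^ n.natAbs := by
  have h := summable_geometric_of_lt_one h₀ h₁
  exact Summable.of_nat_of_neg (by simpa using h) (by simpa using h)

/-- At level `j`, the weighted number of coefficients exceeding `t` decays geometrically away from
the critical level `y`, defined by `2 ^ (a * y) = M / t`. -/
lemma weighted_card_le {a q r M t y : ℝ} (ha : 0 < a) (hr : 0 < r) (hM : 0 < M)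
    (ht : 0 < t) (hy : (2 : ℝ) ^ (a * y) = M / t) (j : ℕ) (b : ℕ → ℝ)
    (hb : (2 : ℝ) ^ ((j : ℝ) * (a - 1 / r)) *
      (∑ k ∈ Finset.range (2 ^ j), |b k| ^ r) ^ (1 / r) ≤ M) :
    (((Finset.range (2 ^ j)).filter fun k => t < |b k|).card : ℝ) *
        (2 : ℝ) ^ ((j : ℝ) * (a * q - 1)) ≤
      (M / t) ^ q * (2 : ℝ) ^ (-(a * min q (r - q) * |(j : ℝ) - y|)) := by
  set N : ℝ := (((Finset.range (2 ^ j)).filter fun k => t < |b k|).card : ℝ) with hN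
  set S := ∑ k ∈ Finset.range (2 ^ j), |b k| ^ r
  have hS₀ : 0 ≤ S := Finset.sum_nonneg fun _ _ => by positivity
  have two_pos : (0 : ℝ) < 2 := two_pos
  have hcard : N ≤ (2 : ℝ) ^ (j : ℝ) := by
    have := Finset.card_filter_le (Finset.range (2 ^ j)) fun k => t < |b k|
    rw [Finset.card_range] at this
    rw [Real.rpow_natCast, hN]
    exact_mod_cast this
  have hcheb : N ≤ (2 : ℝ) ^ (a * r * y - j * (a * r) + j) := by
    have h₁ : N * t ^ r ≤ S := card_filter_lt_abs_mul_rpow_le _ b ht hr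
    have h₂ := Real.rpow_le_rpow (by positivity) hb hr.le
    rw [Real.mul_rpow (by positivity) (by positivity), ← Real.rpow_mul hS₀,
      one_div_mul_cancel hr.ne', Real.rpow_one, ← Real.rpow_mul two_pos.le] at h₂
    have h₃ : (2 : ℝ) ^ (a * r * y - j * (a * r) + j) =
        (M / t) ^ r * (2 : ℝ) ^ (-((j : ℝ) * (a - 1 / r) * r)) := by
      rw [← hy, ← Real.rpow_mul two_pos.le, ← Real.rpow_add two_pos]
      congr 1
      field_simp
      ring
    rw [h₃, Real.div_rpow hM.le ht.le, Real.rpow_neg two_pos.le, ← div_eq_mul_inv, div_div,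
      le_div_iff₀ (by positivity)]
    calc N * (t ^ r * (2 : ℝ) ^ ((j : ℝ) * (a - 1 / r) * r))
        = (2 : ℝ) ^ ((j : ℝ) * (a - 1 / r) * r) * (N * t ^ r) := by ring
      _ ≤ (2 : ℝ) ^ ((j : ℝ) * (a - 1 / r) * r) * S := by gcongr
      _ ≤ M ^ r := h₂
  have hmin : N * (2 : ℝ) ^ ((j : ℝ) * (a * q - 1)) ≤
      (2 : ℝ) ^ min (j * (a * q)) (a * r * y - j * (a * r) + j * (a * q)) := by
    rcases min_choice ((j : ℝ) * (a * q)) (a * r * y - j * (a * r) + j * (a * q)) with h | h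
    · rw [h]
      refine (mul_le_mul_of_nonneg_right hcard (by positivity)).trans_eq ?_
      rw [← Real.rpow_add two_pos]
      ring_nf
    · rw [h]
      refine (mul_le_mul_of_nonneg_right hcheb (by positivity)).trans_eq ?_
      rw [← Real.rpow_add two_pos]
      ring_nf
  refine hmin.trans ((Real.rpow_le_rpow_of_exponent_le one_le_two (min_exponent_le ha)).trans_eq ?_)
  rw [← hy, ← Real.rpow_mul two_pos.le, ← Real.rpow_add two_pos]
  ring_nf

/-- Part 1 of Theorem A.1 (dense regime): if `π > q_D = p/(2s+1)`, then the Besov ball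
`B^s_{π,∞}` of radius `M` embeds in weak-`ℓ_{q_D}` with weights `μ{(j,k)} = 2^{j(p/2-1)}`:
`sup_{λ>0} λ^{q_D} Σ_{(j,k): |β_{j,k}|>λ} 2^{j(p/2-1)} ≤ C M^{q_D}`. -/
theorem stmt_12 (p s π : ℝ) (hp : 0 < p) (hs : 0 < s) (hπ : p / (2 * s + 1) < π) :
    ∃ C : ℝ, ∀ M : ℝ, 0 < M → ∀ β : ℕ → ℕ → ℝ,
      (∀ j : ℕ, (2 : ℝ) ^ ((j : ℝ) * (s + 1 / 2 - 1 / π)) *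
          (∑ k ∈ Finset.range (2 ^ j), |β j k| ^ π) ^ (1 / π) ≤ M) →
      ∀ lam : ℝ, 0 < lam →
        ENNReal.ofReal (lam ^ (p / (2 * s + 1))) *
            ∑' j : ℕ, ∑ k ∈ Finset.range (2 ^ j),
              (if lam < |β j k| then (2 : ℝ≥0∞) ^ ((j : ℝ) * (p / 2 - 1)) else 0) ≤
          ENNReal.ofReal (C * M ^ (p / (2 * s + 1))) := by
  set q := p / (2 * s + 1) with hq
  set a := s + 1 / 2 with ha_def
  have ha : 0 < a := by positivity
  have hq₀ : 0 < q := by positivity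
  have hπ₀ : 0 < π := hq₀.trans hπ
  have haq : p / 2 = a * q := by rw [hq, ha_def]; field_simp
  set c := a * min q (π - q) with hc_def
  have hc : 0 < c := mul_pos ha (lt_min hq₀ (sub_pos.mpr hπ))
  set ρ : ℝ := (2 : ℝ) ^ (-c) with hρ
  have hρ₀ : 0 ≤ ρ := by positivity
  have hsum := summable_pow_natAbs hρ₀
    (Real.rpow_lt_one_of_one_lt_of_neg one_lt_two (neg_lt_zero.mpr hc))
  refine ⟨(2 : ℝ) ^ c * ∑' n : ℤ, ρ ^ n.natAbs, fun M hM β hβ lam hlam => ?_⟩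
  obtain ⟨y, hy⟩ : ∃ y : ℝ, (2 : ℝ) ^ (a * y) = M / lam := by
    refine ⟨Real.logb 2 (M / lam) / a, ?_⟩
    rw [mul_div_cancel₀ _ ha.ne', Real.rpow_logb two_pos (by norm_num) (by positivity)]
  have hlevel (j : ℕ) : (∑ k ∈ Finset.range (2 ^ j),
      (if lam < |β j k| then (2 : ℝ≥0∞) ^ ((j : ℝ) * (p / 2 - 1)) else 0)) ≤
        ENNReal.ofReal ((M / lam) ^ q * (2 : ℝ) ^ c) *
          ENNReal.ofReal (ρ ^ ((j : ℤ) - ⌊y⌋).natAbs) := by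
    rw [← Finset.sum_filter, Finset.sum_const, nsmul_eq_mul, haq,
      ← ENNReal.ofReal_ofNat 2, ENNReal.ofReal_rpow_of_pos two_pos, ← ENNReal.ofReal_natCast,
      ← ENNReal.ofReal_mul (by positivity), ← ENNReal.ofReal_mul (by positivity)]
    refine ENNReal.ofReal_le_ofReal
      ((weighted_card_le (q := q) ha hπ₀ hM hlam hy j (β j) (hβ j)).trans ?_)
    rw [← hc_def, mul_assoc ((M / lam) ^ q), hρ, ← Real.rpow_natCast,
      ← Real.rpow_mul two_pos.le, ← Real.rpow_add two_pos]
    gcongr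
    · exact one_le_two
    · nlinarith [natAbs_sub_floor_sub_one_le j y]
  have hinj : Function.Injective fun j : ℕ => (j : ℤ) - ⌊y⌋ := fun i j h => by
    simpa using h
  calc _ ≤ ENNReal.ofReal (lam ^ q) * ∑' j : ℕ, ENNReal.ofReal ((M / lam) ^ q * (2 : ℝ) ^ c) *
          ENNReal.ofReal (ρ ^ ((j : ℤ) - ⌊y⌋).natAbs) := by
        gcongr with j
        exact hlevel j
    _ ≤ ENNReal.ofReal (lam ^ q) * (ENNReal.ofReal ((M / lam) ^ q * (2 : ℝ) ^ c) *
          ∑' n : ℤ, ENNReal.ofReal (ρ ^ n.natAbs)) := by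
        rw [ENNReal.tsum_mul_left]
        gcongr
        exact ENNReal.tsum_comp_le_tsum_of_injective hinj fun n : ℤ =>
          ENNReal.ofReal (ρ ^ n.natAbs)
    _ = _ := by
        rw [← ENNReal.ofReal_tsum_of_nonneg (fun _ => by positivity) hsum,
          ← ENNReal.ofReal_mul (by positivity), ← ENNReal.ofReal_mul (by positivity),
          Real.div_rpow hM.le hlam.le]
        congr 1
        field_simp
end

section
/- Let 0 < p < ∞, s > 0, and let π satisfy 2/(2s+1) < π < p/(2s+1); set q_S = (p/2−1)/(s+1/2−1/π), which is strictly positive. Then there exists a constant C < ∞, depending only on p, s and π, such that for every M > 0 and every doubly-indexed real sequence β = (β_{j,k})_{j≥0, 0≤k<2^j} with sup_{j≥0} 2^{j(s+1/2−1/π)} (Σ_{k=0}^{2^j−1} |β_{j,k}|^π)^{1/π} ≤ M, one has sup_{λ>0} λ^{q_S} Σ_{(j,k): |β_{j,k}|>λ} 2^{j(p/2−1)} ≤ C·M^{q_S}. -/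
open MeasureTheory ENNReal

/-- The powers of `r > 1` lying below a threshold `T` sum to at most `T * (r / (r - 1))`. -/
lemma sum_range_pow_lt_le {r T : ℝ} (hr : 1 < r) (hT : 0 ≤ T) (n : ℕ) :
    ∑ j ∈ Finset.range n, (if r ^ j < T then r ^ j else 0) ≤ T * (r / (r - 1)) := by
  have hr1 : 0 < r - 1 := by linarith
  induction n with
  | zero => simpa using by positivity
  | succ n ih =>
    by_cases h : r ^ n < T
    · calc ∑ j ∈ Finset.range (n + 1), (if r ^ j < T then r ^ j else 0)
          ≤ ∑ j ∈ Finset.range (n + 1), r ^ j := by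
            refine Finset.sum_le_sum fun j _ => ?_
            split_ifs
            · exact le_rfl
            · positivity
        _ = (r ^ (n + 1) - 1) / (r - 1) := geom_sum_eq hr.ne' _
        _ ≤ T * (r / (r - 1)) := by
            rw [← mul_div_assoc]
            gcongr
            rw [pow_succ]
            nlinarith
    · rw [Finset.sum_range_succ, if_neg h, add_zero]
      exact ih

/-- Chebyshev's inequality for a finite sum of powers. -/
lemma card_filter_mul_rpow_le {ι : Type*} (u : Finset ι) (x : ι → ℝ) {q lam : ℝ} (hq : 0 ≤ q)
    (hlam : 0 ≤ lam) :
    ((u.filter fun k => lam < |x k|).card : ℝ) * lam ^ q ≤ ∑ k ∈ u, |x k| ^ q := by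
  rw [← nsmul_eq_mul, ← Finset.sum_const]
  calc ∑ _k ∈ u.filter (fun k => lam < |x k|), lam ^ q
      ≤ ∑ k ∈ u.filter (fun k => lam < |x k|), |x k| ^ q :=
        Finset.sum_le_sum fun k hk =>
          Real.rpow_le_rpow hlam (Finset.mem_filter.1 hk).2.le hq
    _ ≤ ∑ k ∈ u, |x k| ^ q :=
        Finset.sum_le_sum_of_subset_of_nonneg (Finset.filter_subset _ _)
          fun _ _ _ => by positivity

/-- At one resolution level of a Besov ball of radius `M`, the weighted number of coefficients
exceeding `lam` is at most `(M / lam) ^ q * 2 ^ (j * (b - a * q))`, and it vanishes at levels whose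
weight `2 ^ (j * (b - a * q))` is not below `(M / lam) ^ ((b - a * q) / a)`. -/
lemma card_filter_mul_weight_le {ι : Type*} (u : Finset ι) (x : ι → ℝ) (j : ℕ)
    {a b q M lam : ℝ} (ha : 0 < a) (hq : 0 < q) (hc : 0 < b - a * q) (hM : 0 < M)
    (hlam : 0 < lam)
    (h : (2 : ℝ) ^ ((j : ℝ) * a) * (∑ k ∈ u, |x k| ^ q) ^ (1 / q) ≤ M) :
    ((u.filter fun k => lam < |x k|).card : ℝ) * (2 : ℝ) ^ ((j : ℝ) * b) ≤
      (M / lam) ^ q * (if ((2 : ℝ) ^ (b - a * q)) ^ j < (M / lam) ^ ((b - a * q) / a)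
        then ((2 : ℝ) ^ (b - a * q)) ^ j else 0) := by
  have hpow : ((2 : ℝ) ^ (b - a * q)) ^ j = (2 : ℝ) ^ ((j : ℝ) * (b - a * q)) := by
    rw [← Real.rpow_mul_natCast (by norm_num), mul_comm]
  set N : ℝ := ((u.filter fun k => lam < |x k|).card : ℝ) with hN
  set w : ℝ := (2 : ℝ) ^ ((j : ℝ) * a) with hw
  have hw0 : 0 < w := by positivity
  have hS0 : 0 ≤ ∑ k ∈ u, |x k| ^ q := Finset.sum_nonneg fun _ _ => by positivity
  have hS : ∑ k ∈ u, |x k| ^ q ≤ (M / w) ^ q := by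
    have h1 : (∑ k ∈ u, |x k| ^ q) ^ (1 / q) ≤ M / w := by
      rw [le_div_iff₀ hw0, mul_comm]
      exact h
    have h2 := Real.rpow_le_rpow (by positivity) h1 hq.le
    rwa [← Real.rpow_mul hS0, one_div_mul_cancel hq.ne', Real.rpow_one] at h2
  have hcard : N ≤ (M / lam) ^ q * w ^ (-q) := by
    have h1 := (card_filter_mul_rpow_le u x hq.le hlam.le).trans hS
    rw [← le_div_iff₀ (by positivity)] at h1
    refine h1.trans_eq ?_
    rw [Real.div_rpow hM.le hw0.le, Real.div_rpow hM.le hlam.le, Real.rpow_neg hw0.le]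
    field_simp
  have hsplit : w ^ (-q) * (2 : ℝ) ^ ((j : ℝ) * b) = ((2 : ℝ) ^ (b - a * q)) ^ j := by
    rw [hpow, hw, ← Real.rpow_mul (by norm_num), ← Real.rpow_add (by norm_num)]
    congr 1
    ring
  rcases (u.filter fun k => lam < |x k|).eq_empty_or_nonempty with hemp | ⟨k, hk⟩
  · rw [hN, hemp, Finset.card_empty, Nat.cast_zero, zero_mul]
    positivity
  · obtain ⟨hku, hk⟩ := Finset.mem_filter.1 hk
    have hlt : w < M / lam := by
      have h1 : lam ^ q < (M / w) ^ q :=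
        (Real.rpow_lt_rpow hlam.le hk hq).trans_le <|
          (Finset.single_le_sum (f := fun k => |x k| ^ q)
            (fun _ _ => by positivity) hku).trans hS
      rw [Real.rpow_lt_rpow_iff hlam.le (by positivity) hq, lt_div_iff₀ hw0] at h1
      rw [lt_div_iff₀ hlam, mul_comm]
      exact h1
    have hthr : ((2 : ℝ) ^ (b - a * q)) ^ j < (M / lam) ^ ((b - a * q) / a) := by
      have h1 := Real.rpow_lt_rpow hw0.le hlt (div_pos hc ha)
      rwa [hw, ← Real.rpow_mul (by norm_num), mul_assoc, mul_div_cancel₀ _ ha.ne', ← hpow] at h1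
    rw [if_pos hthr, ← hsplit, ← mul_assoc]
    gcongr

/-- Part 3 of Theorem A.1 (sparse regime): if `2/(2s+1) < π < p/(2s+1)` and
`q_S = (p/2-1)/(s+1/2-1/π)` (which is strictly positive), then the Besov ball
`B^s_{π,∞}` of radius `M` embeds in weak-`ℓ_{q_S}` with weights `μ{(j,k)} = 2^{j(p/2-1)}`:
`sup_{λ>0} λ^{q_S} Σ_{(j,k): |β_{j,k}|>λ} 2^{j(p/2-1)} ≤ C M^{q_S}`. -/
theorem stmt_13 (p s π : ℝ) (hp : 0 < p) (hs : 0 < s)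
    (hπlo : 2 / (2 * s + 1) < π) (hπhi : π < p / (2 * s + 1)) :
    ∃ C : ℝ, ∀ M : ℝ, 0 < M → ∀ β : ℕ → ℕ → ℝ,
      (∀ j : ℕ, (2 : ℝ) ^ ((j : ℝ) * (s + 1 / 2 - 1 / π)) *
          (∑ k ∈ Finset.range (2 ^ j), |β j k| ^ π) ^ (1 / π) ≤ M) →
      ∀ lam : ℝ, 0 < lam →
        ENNReal.ofReal (lam ^ ((p / 2 - 1) / (s + 1 / 2 - 1 / π))) *
            ∑' j : ℕ, ∑ k ∈ Finset.range (2 ^ j),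
              (if lam < |β j k| then (2 : ℝ≥0∞) ^ ((j : ℝ) * (p / 2 - 1)) else 0) ≤
          ENNReal.ofReal (C * M ^ ((p / 2 - 1) / (s + 1 / 2 - 1 / π))) := by
  have hs1 : 0 < 2 * s + 1 := by linarith
  have hπ : 0 < π := lt_trans (by positivity) hπlo
  rw [div_lt_iff₀ hs1] at hπlo
  rw [lt_div_iff₀ hs1] at hπhi
  have haπ : (s + 1 / 2 - 1 / π) * π = π * (2 * s + 1) / 2 - 1 := by
    field_simp
  set a : ℝ := s + 1 / 2 - 1 / π
  set b : ℝ := p / 2 - 1 with hb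
  have ha : 0 < a := pos_of_mul_pos_left (by rw [haπ]; linarith) hπ.le
  have hc : 0 < b - a * π := by rw [haπ, hb]; linarith
  set r : ℝ := (2 : ℝ) ^ (b - a * π)
  have hr : 1 < r := Real.one_lt_rpow (by norm_num) hc
  refine ⟨r / (r - 1), fun M hM β hβ lam hlam => ?_⟩
  have hR : 0 < M / lam := by positivity
  have hsum : ∑' j : ℕ, ∑ k ∈ Finset.range (2 ^ j),
      (if lam < |β j k| then (2 : ℝ≥0∞) ^ ((j : ℝ) * b) else 0) ≤
      ENNReal.ofReal ((M / lam) ^ (b / a) * (r / (r - 1))) := by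
    refine ENNReal.tsum_le_of_sum_range_le fun n => ?_
    have hlevel : ∀ j : ℕ, ∑ k ∈ Finset.range (2 ^ j),
        (if lam < |β j k| then (2 : ℝ≥0∞) ^ ((j : ℝ) * b) else 0) ≤
        ENNReal.ofReal ((M / lam) ^ π *
          (if r ^ j < (M / lam) ^ ((b - a * π) / a) then r ^ j else 0)) := by
      intro j
      refine le_trans (le_of_eq ?_) (ENNReal.ofReal_le_ofReal
        (card_filter_mul_weight_le (Finset.range (2 ^ j)) (β j) j ha hπ hc hM hlam (hβ j)))
      rw [← Finset.sum_filter, Finset.sum_const, nsmul_eq_mul,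
        ENNReal.ofReal_mul (Nat.cast_nonneg _), ENNReal.ofReal_natCast,
        ← ENNReal.ofReal_rpow_of_pos (by norm_num), ENNReal.ofReal_ofNat]
    refine (Finset.sum_le_sum fun j _ => hlevel j).trans ?_
    rw [← ENNReal.ofReal_sum_of_nonneg fun _ _ => by positivity, ← Finset.mul_sum]
    refine ENNReal.ofReal_le_ofReal ?_
    have hexp : (M / lam) ^ (b / a) = (M / lam) ^ π * (M / lam) ^ ((b - a * π) / a) := by
      rw [← Real.rpow_add hR]
      congr 1
      field_simp
      ring
    rw [hexp, mul_assoc]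
    gcongr
    exact sum_range_pow_lt_le hr (by positivity) n
  refine (mul_le_mul_right hsum _).trans ?_
  rw [← ENNReal.ofReal_mul (by positivity), Real.div_rpow hM.le hlam.le]
  refine ENNReal.ofReal_le_ofReal (le_of_eq ?_)
  have := Real.rpow_pos_of_pos hlam (b / a)
  field_simp
end

section
/- Let p > 2, s > 0, π = p/(2s+1), and r > p. Then there exists a constant C < ∞, depending only on p, s and r, such that for every M > 0 and every doubly-indexed real sequence β = (β_{j,k})_{j≥0, 0≤k<2^j} with sup_{j≥0} 2^{j(s+1/2−1/π)} (Σ_{k=0}^{2^j−1} |β_{j,k}|^π)^{1/π} ≤ M, one has Σ_{j≥0} Σ_{k=0}^{2^j−1} |β_{j,k}|^r · 2^{j(p/2−1)} ≤ C·M^r. -/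
open MeasureTheory ENNReal

/-- The `ℓ_r` norm is dominated by the `ℓ_q` norm for `q ≤ r`, in `r`-th power form. -/
lemma sum_abs_rpow_le_lq_norm_rpow {ι : Type*} (t : Finset ι) (f : ι → ℝ) {q r : ℝ}
    (hq : 0 < q) (hqr : q ≤ r) :
    ∑ k ∈ t, |f k| ^ r ≤ ((∑ k ∈ t, |f k| ^ q) ^ (1 / q)) ^ r := by
  set S := ∑ k ∈ t, |f k| ^ q with hS
  have hS0 : 0 ≤ S := Finset.sum_nonneg fun k _ => by positivity
  have hT0 : 0 ≤ S ^ (1 / q) := by positivity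
  have hle : ∀ k ∈ t, |f k| ≤ S ^ (1 / q) := fun k hk => by
    rw [one_div, Real.le_rpow_inv_iff_of_pos (abs_nonneg _) hS0 hq]
    exact Finset.single_le_sum (f := fun k => |f k| ^ q) (fun i _ => by positivity) hk
  have hsplit : ∀ x : ℝ, 0 ≤ x → x ^ r = x ^ q * x ^ (r - q) := fun x hx => by
    rw [← Real.rpow_add_of_nonneg hx hq.le (by linarith)]
    congr 1
    ring
  calc ∑ k ∈ t, |f k| ^ r ≤ ∑ k ∈ t, |f k| ^ q * (S ^ (1 / q)) ^ (r - q) := by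
        refine Finset.sum_le_sum fun k hk => ?_
        rw [hsplit _ (abs_nonneg _)]
        have := Real.rpow_le_rpow (abs_nonneg _) (hle k hk) (by linarith : 0 ≤ r - q)
        gcongr
    _ = (S ^ (1 / q)) ^ r := by
        rw [← Finset.sum_mul, ← hS, hsplit _ hT0, ← Real.rpow_mul hS0 (1 / q) q,
          one_div_mul_cancel hq.ne', Real.rpow_one]

/-- The `p > 2`, `r > p` clause of part 2 of Theorem A.1: at the critical index
`π = p/(2s+1)`, the Besov ball `B^s_{π,∞}` of radius `M` embeds in `ℓ_r` with weights
`μ{(j,k)} = 2^{j(p/2-1)}`: `Σ_{j,k} |β_{j,k}|^r 2^{j(p/2-1)} ≤ C M^r`. -/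
theorem stmt_14 (p s r : ℝ) (hp : 2 < p) (hs : 0 < s) (hr : p < r) :
    ∃ C : ℝ, ∀ M : ℝ, 0 < M → ∀ β : ℕ → ℕ → ℝ,
      (∀ j : ℕ, (2 : ℝ) ^ ((j : ℝ) * (s + 1 / 2 - 1 / (p / (2 * s + 1)))) *
          (∑ k ∈ Finset.range (2 ^ j), |β j k| ^ (p / (2 * s + 1))) ^ (1 / (p / (2 * s + 1))) ≤ M) →
      ∑' j : ℕ, ∑ k ∈ Finset.range (2 ^ j),
          ENNReal.ofReal (|β j k| ^ r * (2 : ℝ) ^ ((j : ℝ) * (p / 2 - 1))) ≤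
        ENNReal.ofReal (C * M ^ r) := by
  set q := p / (2 * s + 1) with hq_def
  have hq : 0 < q := by positivity
  have hqp : q < p := div_lt_self (by linarith) (by linarith)
  have hexp : s + 1 / 2 - 1 / q = (p / 2 - 1) / q := by
    rw [hq_def]
    have : p ≠ 0 := by linarith
    field_simp
  rw [hexp]
  set ρ : ℝ := 2 ^ ((p / 2 - 1) * (1 - r / q)) with hρ
  have hρ0 : 0 ≤ ρ := by positivity
  have hρ1 : ρ < 1 := by
    refine Real.rpow_lt_one_of_one_lt_of_neg one_lt_two
      (mul_neg_of_pos_of_neg (by linarith) ?_)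
    have : 1 < r / q := (one_lt_div hq).2 (by linarith)
    linarith
  refine ⟨(1 - ρ)⁻¹, fun M hM β hβ => ?_⟩
  have hlevel : ∀ j : ℕ, ∑ k ∈ Finset.range (2 ^ j),
      ENNReal.ofReal (|β j k| ^ r * (2 : ℝ) ^ ((j : ℝ) * (p / 2 - 1))) ≤
        ENNReal.ofReal (ρ ^ j * M ^ r) := fun j => by
    rw [← ENNReal.ofReal_sum_of_nonneg fun k _ => by positivity, ← Finset.sum_mul]
    refine ENNReal.ofReal_le_ofReal ?_
    set T := (∑ k ∈ Finset.range (2 ^ j), |β j k| ^ q) ^ (1 / q) with hT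
    have hT0 : 0 ≤ T := by positivity
    have hMr : (2 : ℝ) ^ ((j : ℝ) * ((p / 2 - 1) / q) * r) * T ^ r ≤ M ^ r := by
      rw [Real.rpow_mul zero_le_two, ← Real.mul_rpow (by positivity) hT0]
      exact Real.rpow_le_rpow (by positivity) (hβ j) (by linarith)
    have hweight : (2 : ℝ) ^ ((j : ℝ) * (p / 2 - 1)) =
        ρ ^ j * 2 ^ ((j : ℝ) * ((p / 2 - 1) / q) * r) := by
      rw [hρ, ← Real.rpow_mul_natCast zero_le_two, ← Real.rpow_add two_pos]
      congr 1
      ring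
    calc (∑ k ∈ Finset.range (2 ^ j), |β j k| ^ r) * (2 : ℝ) ^ ((j : ℝ) * (p / 2 - 1))
        ≤ T ^ r * (2 : ℝ) ^ ((j : ℝ) * (p / 2 - 1)) := by
          gcongr
          exact sum_abs_rpow_le_lq_norm_rpow _ _ hq (by linarith)
      _ = ρ ^ j * (2 ^ ((j : ℝ) * ((p / 2 - 1) / q) * r) * T ^ r) := by
          rw [hweight]
          ring
      _ ≤ ρ ^ j * M ^ r := by gcongr
  have hgeom := (hasSum_geometric_of_lt_one hρ0 hρ1).mul_right (M ^ r)
  refine (ENNReal.tsum_le_tsum hlevel).trans_eq ?_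
  rw [← ENNReal.ofReal_tsum_of_nonneg (fun j => by positivity) hgeom.summable, hgeom.tsum_eq]
end

section
/- Let (Ω, F) be a measurable space carrying pairwise mutually absolutely continuous probability measures P₀, P₁, …, P_K, let (V, d) be a metric space (with its Borel σ-algebra), and let f₀, f₁, …, f_K ∈ V satisfy d(f_k, f_{k'}) ≥ δ for all k ≠ k', where δ > 0. Suppose there are π₀ > 0 and λ_n > 0 with K ≥ exp(λ_n), and for each k = 1,…,K the log-likelihood ratio decomposes as log(dP₀/dP_k) = u_k − v_k, where v_k is a real constant with v_k ≤ λ_n and u_k is a random variable with P_k(u_k > 0) ≥ π₀. Then for every measurable map (estimator) f̂ : Ω → V, max_{0 ≤ k ≤ K} P_k(d(f̂, f_k) ≥ δ/2) ≥ π₀/2. -/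
open MeasureTheory ProbabilityTheory

/-- A change of measure: if `c ≤ log (dμ/dν)` holds `ν`-almost everywhere on `s`, then
`exp c * ν s ≤ μ s`. -/
theorem exp_mul_measureReal_le_of_le_log_rnDeriv {Ω : Type*} [MeasurableSpace Ω]
    {μ ν : Measure Ω} [IsFiniteMeasure μ] [IsFiniteMeasure ν] (hμν : μ ≪ ν) (hνμ : ν ≪ μ)
    {s : Set Ω} (hs : MeasurableSet s) (c : ℝ)
    (h : ∀ᵐ ω ∂ν, ω ∈ s → c ≤ Real.log ((μ.rnDeriv ν ω).toReal)) :
    Real.exp c * ν.real s ≤ μ.real s := by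
  have hle : ENNReal.ofReal (Real.exp c) * ν s ≤ μ s := by
    rw [← Measure.setLIntegral_rnDeriv hμν s, ← setLIntegral_const]
    refine setLIntegral_mono_ae' hs ?_
    filter_upwards [h, Measure.rnDeriv_pos' hνμ, Measure.rnDeriv_lt_top μ ν]
      with ω hω hpos hlt hmem
    have hpos' := ENNReal.toReal_pos hpos.ne' hlt.ne
    exact (ENNReal.ofReal_le_iff_le_toReal hlt.ne).2
      ((Real.le_log_iff_exp_le hpos').1 (hω hmem))
  simpa [Measure.real, ENNReal.toReal_mul, ENNReal.toReal_ofReal (Real.exp_pos c).le] using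
    ENNReal.toReal_mono (measure_ne_top μ s) hle

/-- Preimages of the balls of radius `δ / 2` around two `δ`-separated points are disjoint. -/
theorem disjoint_preimage_ball_of_le_dist {Ω V : Type*} [PseudoMetricSpace V] {x y : V} {δ : ℝ}
    (h : δ ≤ dist x y) (g : Ω → V) :
    Disjoint {ω | dist (g ω) x < δ / 2} {ω | dist (g ω) y < δ / 2} :=
  (Metric.ball_disjoint_ball (by simpa using h)).preimage g

/-- Lemma 6.1 (Korostelev–Tsybakov lower bound lemma): given pairwise mutually
absolutely continuous probability measures `P₀,…,P_K`, `δ`-separated points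
`f₀,…,f_K` in a metric space, and log-likelihood decompositions
`log(dP₀/dP_k) = u_k - v_k` with `v_k ≤ λ_n`, `K ≥ exp(λ_n)` and
`P_k(u_k > 0) ≥ π₀`, any estimator `f̂` satisfies
`max_k P_k(d(f̂, f_k) ≥ δ/2) ≥ π₀/2`. -/
theorem stmt_15 {Ω : Type*} [MeasurableSpace Ω]
    {V : Type*} [MetricSpace V] [MeasurableSpace V] [BorelSpace V]
    (K : ℕ) (P : Fin (K + 1) → Measure Ω) [∀ k, IsProbabilityMeasure (P k)]
    (hac : ∀ k k', P k ≪ P k')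
    (f : Fin (K + 1) → V) (δ : ℝ) (hδ : 0 < δ)
    (hsep : ∀ k k', k ≠ k' → δ ≤ dist (f k) (f k'))
    (π₀ lamn : ℝ) (hπ₀ : 0 < π₀) (hlamn : 0 < lamn)
    (hK : Real.exp lamn ≤ (K : ℝ))
    (u : Fin (K + 1) → Ω → ℝ) (v : Fin (K + 1) → ℝ)
    (humeas : ∀ k, Measurable (u k))
    (hdecomp : ∀ k : Fin (K + 1), k ≠ 0 →
      ∀ᵐ ω ∂(P k), Real.log (((P 0).rnDeriv (P k) ω).toReal) = u k ω - v k)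
    (hv : ∀ k : Fin (K + 1), k ≠ 0 → v k ≤ lamn)
    (hu : ∀ k : Fin (K + 1), k ≠ 0 → π₀ ≤ (P k {ω | 0 < u k ω}).toReal)
    (fhat : Ω → V) (hfhat : Measurable fhat) :
    ∃ k : Fin (K + 1), π₀ / 2 ≤ (P k {ω | δ / 2 ≤ dist (fhat ω) (f k)}).toReal := by
  by_contra! hcon
  have hsmall (k) : MeasurableSet {ω | dist (fhat ω) (f k) < δ / 2} :=
    measurableSet_lt ((continuous_id.dist continuous_const).measurable.comp hfhat)
      measurable_const
  have hlower (j : Fin K) : Real.exp (-lamn) * (π₀ / 2) ≤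
      (P 0).real {ω | dist (fhat ω) (f j.succ) < δ / 2} := by
    have hj := Fin.succ_ne_zero j
    have hpos : MeasurableSet {ω | 0 < u j.succ ω} :=
      measurableSet_lt measurable_const (humeas _)
    have hcover : (P j.succ).real {ω | 0 < u j.succ ω} ≤
        (P j.succ).real ({ω | dist (fhat ω) (f j.succ) < δ / 2} ∩ {ω | 0 < u j.succ ω}) +
          (P j.succ).real {ω | δ / 2 ≤ dist (fhat ω) (f j.succ)} := by
      refine (measureReal_mono fun ω hω => ?_).trans (measureReal_union_le _ _)
      rcases lt_or_ge (dist (fhat ω) (f j.succ)) (δ / 2) with h | h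
      · exact Or.inl ⟨h, hω⟩
      · exact Or.inr h
    have hchange := exp_mul_measureReal_le_of_le_log_rnDeriv (hac 0 j.succ) (hac j.succ 0)
      ((hsmall j.succ).inter hpos) (-lamn) (by
        filter_upwards [hdecomp j.succ hj] with ω hω hmem
        have hmem_pos : 0 < u j.succ ω := hmem.2
        linarith [hv j.succ hj])
    refine le_trans ?_ (hchange.trans (measureReal_mono Set.inter_subset_left))
    have hmass : π₀ ≤ (P j.succ).real {ω | 0 < u j.succ ω} := hu j.succ hj
    have herr : (P j.succ).real {ω | δ / 2 ≤ dist (fhat ω) (f j.succ)} < π₀ / 2 := hcon j.succ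
    gcongr
    linarith
  have hsum : ∑ j : Fin K, (P 0).real {ω | dist (fhat ω) (f j.succ) < δ / 2} ≤
      (P 0).real {ω | δ / 2 ≤ dist (fhat ω) (f 0)} := by
    rw [← measureReal_iUnion_fintype
      (fun i j hij => disjoint_preimage_ball_of_le_dist
        (hsep _ _ ((Fin.succ_injective K).ne hij)) fhat)
      (fun j => hsmall j.succ)]
    refine measureReal_mono (Set.iUnion_subset fun j ω hω => ?_)
    have hnot := Set.disjoint_left.1 (disjoint_preimage_ball_of_le_dist
      (hsep _ _ (Fin.succ_ne_zero j)) fhat) hω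
    simpa using hnot
  have hcount : (K : ℝ) * (Real.exp (-lamn) * (π₀ / 2)) ≤
      (P 0).real {ω | δ / 2 ≤ dist (fhat ω) (f 0)} := by
    refine le_trans ?_ ((Finset.sum_le_sum fun j _ => hlower j).trans hsum)
    simp
  have hone : 1 ≤ (K : ℝ) * Real.exp (-lamn) := by
    calc (1 : ℝ) = Real.exp lamn * Real.exp (-lamn) := by simp [← Real.exp_add]
      _ ≤ K * Real.exp (-lamn) := by gcongr
  have herr : (P 0).real {ω | δ / 2 ≤ dist (fhat ω) (f 0)} < π₀ / 2 := hcon 0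
  nlinarith
end
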